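/- Let k ≥ 2 be an integer and let ε > 0. Define A*_k(Z) = A_k(2Z) − A_k(Z). Then there exists a constant C = C(k,ε) > 0 such that for all real Z ≥ 1 one has |A*_k(Z) − c_k·Z| ≤ C·Z^{14/(9k)+ε}. -/

import Mathlib

/-- A positive integer is `k`-free if it is divisible by `p^k` for no prime `p`. -/
def KFree (k n : ℕ) : Prop := ∀ p : ℕ, p.Prime → ¬ p ^ k ∣ n

/-- `Acount k Z` is the number of positive integers `n ≤ Z` such that both `n` and
`n+1` are `k`-free. -/
noncomputable def Acount (k : ℕ) (Z : ℝ) : ℕ :=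
  {n : ℕ | 0 < n ∧ (n : ℝ) ≤ Z ∧ KFree k n ∧ KFree k (n + 1)}.ncard

/-- `ck k` is the infinite product `∏_p (1 - 2/p^k)` over all primes `p`. -/
noncomputable def ck (k : ℕ) : ℝ := ∏' p : Nat.Primes, (1 - 2 / (p : ℝ) ^ k)

/-- `AstarCount k Z = A_k(2Z) - A_k(Z)`. -/
noncomputable def AstarCount (k : ℕ) (Z : ℝ) : ℝ :=
  (Acount k (2 * Z) : ℝ) - (Acount k Z : ℝ)

open Polynomial in
theorem exists_pade_pair (k d : ℕ) :
    ∃ P Q : ℤ[X], ¬ (P = 0 ∧ Q = 0) ∧ P.natDegree ≤ d ∧ Q.natDegree ≤ d ∧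
      (X - 1) ^ (2 * d + 1) ∣ X ^ k * P - Q := by
  have hmonic : ((X - 1 : ℤ[X]) ^ (2 * d + 1)).Monic := (monic_X_sub_C 1).pow _
  let toPoly : (Fin (d + 1) → ℤ) →ₗ[ℤ] ℤ[X] := ∑ i : Fin (d + 1),
    (monomial (R := ℤ) (i : ℕ)) ∘ₗ LinearMap.proj i
  have toPoly_apply (v : Fin (d + 1) → ℤ) : toPoly v = ∑ i : Fin (d + 1), monomial (i : ℕ) (v i) := by
    simp [toPoly]
  have coeff_toPoly (v : Fin (d + 1) → ℤ) (i : Fin (d + 1)) : (toPoly v).coeff i = v i := by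
    rw [toPoly_apply, finsetSum_coeff]
    simp [coeff_monomial, Fin.val_inj]
  have deg_toPoly (v : Fin (d + 1) → ℤ) : (toPoly v).natDegree ≤ d := by
    rw [toPoly_apply]
    refine natDegree_sum_le_of_forall_le _ _ fun i _ => (natDegree_monomial_le _).trans ?_
    omega
  let f : (Fin (d + 1) → ℤ) × (Fin (d + 1) → ℤ) →ₗ[ℤ] (Fin (2 * d + 1) → ℤ) :=
    (LinearMap.pi fun j : Fin (2 * d + 1) => lcoeff ℤ (j : ℕ)) ∘ₗ
      (modByMonicHom ((X - 1 : ℤ[X]) ^ (2 * d + 1))) ∘ₗ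
      ((LinearMap.mulLeft ℤ (X ^ k)) ∘ₗ toPoly ∘ₗ LinearMap.fst _ _ _
        - toPoly ∘ₗ LinearMap.snd _ _ _)
  have hker : LinearMap.ker f ≠ ⊥ := by
    intro hbot
    have := LinearMap.finrank_le_finrank_of_injective (LinearMap.ker_eq_bot.1 hbot)
    simp at this
    omega
  obtain ⟨⟨v, w⟩, hvw, hne⟩ := (Submodule.ne_bot_iff _).1 hker
  refine ⟨toPoly v, toPoly w, ?_, deg_toPoly v, deg_toPoly w, ?_⟩
  · rintro ⟨hv, hw⟩
    apply hne
    ext i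
    · simp [← coeff_toPoly v i, hv]
    · simp [← coeff_toPoly w i, hw]
  · rw [← modByMonic_eq_zero_iff_dvd hmonic]
    ext j
    by_cases hj : j < 2 * d + 1
    · have := congrFun (LinearMap.mem_ker.1 hvw) ⟨j, hj⟩
      simpa [f, modByMonicHom] using this
    · rw [coeff_zero]
      apply coeff_eq_zero_of_degree_lt
      refine (degree_modByMonic_lt _ hmonic).trans_le ?_
      rw [← C_1, degree_pow, degree_X_sub_C]
      simp
      exact_mod_cast (by omega : 2 * d + 1 ≤ j)

open Polynomial in
/-- The numerator of the logarithmic derivative of `Q / (X ^ k * P)`, multiplied by `X`. -/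
noncomputable def logDerivNumerator {R : Type*} [CommRing R] (k : ℕ) (P Q : R[X]) : R[X] :=
  X * (derivative Q * P - derivative P * Q) - (k : R[X]) * (P * Q)

open Polynomial in
theorem pow_dvd_logDerivNumerator {k m : ℕ} {P Q : ℝ[X]}
    (h : (X - 1) ^ (m + 1) ∣ X ^ k * P - Q) :
    (X - 1) ^ m ∣ logDerivNumerator k P Q := by
  obtain ⟨W, hW⟩ := h
  set R := X ^ k * P - Q with hR
  have hQ : Q = X ^ k * P - R := by rw [hR]; ring
  have hd : (X - 1) ^ m ∣ derivative R := by
    rw [hW]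
    simp only [derivative_mul, derivative_pow]
    refine dvd_add (Dvd.dvd.mul_right ?_ _) (Dvd.dvd.mul_right (pow_dvd_pow _ (by omega)) _)
    simp
  have hR' : (X - 1) ^ m ∣ R := hW ▸ (Dvd.dvd.mul_right (pow_dvd_pow _ (by omega)) _)
  have hXk : X * derivative (X ^ k : ℝ[X]) = (k : ℝ[X]) * X ^ k := by
    cases k with
    | zero => simp
    | succ k => simp; ring
  have : logDerivNumerator k P Q
      = derivative R * (-X * P) + R * (X * derivative P + (k : ℝ[X]) * P) := by
    rw [logDerivNumerator, hQ, derivative_sub, derivative_mul]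
    linear_combination P * P * hXk
  rw [this]
  exact dvd_add (hd.mul_right _) (hR'.mul_right _)

open Polynomial in
theorem coeff_X_mul_derivative {R : Type*} [CommRing R] (P : R[X]) (n : ℕ) :
    (X * derivative P).coeff n = n * P.coeff n := by
  cases n with
  | zero => simp
  | succ n => simp [coeff_X_mul, coeff_derivative, mul_comm]

open Polynomial in
theorem natDegree_X_mul_derivative_le {R : Type*} [CommRing R] (P : R[X]) :
    (X * derivative P).natDegree ≤ P.natDegree := by
  rw [natDegree_le_iff_coeff_eq_zero]
  intro n hn
  rw [coeff_X_mul_derivative, coeff_eq_zero_of_natDegree_lt hn, mul_zero]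

open Polynomial in
theorem natDegree_logDerivNumerator_le {k d : ℕ} {P Q : ℝ[X]} (hP : P.natDegree ≤ d)
    (hQ : Q.natDegree ≤ d) : (logDerivNumerator k P Q).natDegree ≤ 2 * d := by
  have hP' := (natDegree_X_mul_derivative_le P).trans hP
  have hQ' := (natDegree_X_mul_derivative_le Q).trans hQ
  have h : logDerivNumerator k P Q = (X * derivative Q) * P - (X * derivative P) * Q
      - (k : ℝ[X]) * (P * Q) := by rw [logDerivNumerator]; ring
  rw [h, two_mul]
  refine (natDegree_sub_le _ _).trans (max_le ((natDegree_sub_le _ _).trans (max_le ?_ ?_)) ?_)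
  · exact natDegree_mul_le_of_le hQ' hP
  · exact natDegree_mul_le_of_le hP' hQ
  · rw [← nsmul_eq_mul]
    exact (natDegree_smul_le _ _).trans (natDegree_mul_le_of_le hP hQ)

open Polynomial in
theorem logDerivNumerator_ne_zero {k d : ℕ} {P Q : ℝ[X]} (hdk : d < k) (hP0 : P ≠ 0)
    (hQ0 : Q ≠ 0) (hQ : Q.natDegree ≤ d) :
    logDerivNumerator k P Q ≠ 0 := by
  intro h0
  have h : logDerivNumerator k P Q = (X * derivative Q) * P - (X * derivative P) * Q
      - C (k : ℝ) * (P * Q) := by rw [logDerivNumerator]; simp; ring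
  have hc := congrArg (fun F => coeff F (Q.natDegree + P.natDegree)) (h.symm.trans h0)
  simp only [coeff_sub, coeff_C_mul, coeff_zero] at hc
  rw [coeff_mul_add_eq_of_natDegree_le (natDegree_X_mul_derivative_le Q) le_rfl,
    add_comm Q.natDegree, coeff_mul_add_eq_of_natDegree_le (natDegree_X_mul_derivative_le P) le_rfl,
    coeff_mul_add_eq_of_natDegree_le le_rfl le_rfl, coeff_X_mul_derivative,
    coeff_X_mul_derivative] at hc
  have hP1 : P.coeff P.natDegree ≠ 0 := leadingCoeff_ne_zero.2 hP0
  have hQ1 : Q.coeff Q.natDegree ≠ 0 := leadingCoeff_ne_zero.2 hQ0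
  have hprod : P.coeff P.natDegree * Q.coeff Q.natDegree
      * ((Q.natDegree : ℝ) - P.natDegree - k) = 0 := by linear_combination hc
  have : (Q.natDegree : ℝ) - P.natDegree - k = 0 := 
    (mul_eq_zero.1 hprod).resolve_left (mul_ne_zero hP1 hQ1)
  have h2 : Q.natDegree = P.natDegree + k := by
    have : (Q.natDegree : ℝ) = P.natDegree + k := by linarith
    exact_mod_cast this
  omega

open Polynomial in
theorem le_two_mul_of_pow_dvd {k d m : ℕ} {P Q : ℝ[X]} (hdk : d < k) (hP0 : P ≠ 0)
    (hQ0 : Q ≠ 0) (hP : P.natDegree ≤ d) (hQ : Q.natDegree ≤ d)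
    (h : (X - 1) ^ (m + 1) ∣ X ^ k * P - Q) : m ≤ 2 * d := by
  have h1 := natDegree_le_of_dvd (pow_dvd_logDerivNumerator h)
    (logDerivNumerator_ne_zero hdk hP0 hQ0 hQ)
  rw [← C_1, natDegree_pow, natDegree_X_sub_C, mul_one] at h1
  exact h1.trans (natDegree_logDerivNumerator_le hP hQ)

open Polynomial in
theorem logDerivNumerator_eq_C_mul {k d : ℕ} {P Q : ℝ[X]} (hdk : d < k) (hP0 : P ≠ 0)
    (hQ0 : Q ≠ 0) (hP : P.natDegree ≤ d) (hQ : Q.natDegree ≤ d)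
    (h : (X - 1) ^ (2 * d + 1) ∣ X ^ k * P - Q) :
    ∃ c : ℝ, c ≠ 0 ∧ logDerivNumerator k P Q = C c * (X - 1) ^ (2 * d) := by
  obtain ⟨W, hW⟩ := pow_dvd_logDerivNumerator h
  have hN := logDerivNumerator_ne_zero hdk hP0 hQ0 hQ
  have hdeg := natDegree_logDerivNumerator_le (k := k) hP hQ
  have hW0 : W ≠ 0 := by rintro rfl; exact hN (by simpa using hW)
  have hmonic : ((X - 1 : ℝ[X]) ^ (2 * d)).Monic := (monic_X_sub_C 1).pow _
  rw [hW, hmonic.natDegree_mul' hW0, ← C_1, natDegree_pow, natDegree_X_sub_C] at hdeg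
  obtain ⟨c, rfl⟩ := natDegree_eq_zero.1 (by omega : W.natDegree = 0)
  refine ⟨c, by rintro rfl; simp at hW0, by rw [hW]; ring⟩

open Polynomial in
theorem pade_ne_zero {k d : ℕ} {P Q : ℝ[X]} (h0 : ¬ (P = 0 ∧ Q = 0))
    (hP : P.natDegree ≤ d) (hQ : Q.natDegree ≤ d)
    (h : (X - 1) ^ (2 * d + 1) ∣ X ^ k * P - Q) : P ≠ 0 ∧ Q ≠ 0 := by
  have hdeg : ∀ F : ℝ[X], F.natDegree ≤ d → (X - 1) ^ (2 * d + 1) ∣ F → F = 0 := by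
    intro F hF hdvd
    by_contra hne
    have := natDegree_le_of_dvd hdvd hne
    rw [← C_1, natDegree_pow, natDegree_X_sub_C] at this
    omega
  constructor
  · rintro rfl
    exact h0 ⟨rfl, hdeg Q hQ (by simpa using h)⟩
  · rintro rfl
    refine h0 ⟨hdeg P hP ?_, rfl⟩
    have hcop : IsCoprime ((X - 1 : ℝ[X]) ^ (2 * d + 1)) (X ^ k) :=
      IsCoprime.pow ⟨-1, 1, by ring⟩
    exact hcop.dvd_of_dvd_mul_left (by simpa using h)

open Polynomial in
theorem eval_one_pade_ne_zero {k d : ℕ} {P Q : ℝ[X]} (hdk : d < k) (h0 : ¬ (P = 0 ∧ Q = 0))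
    (hP : P.natDegree ≤ d) (hQ : Q.natDegree ≤ d)
    (h : (X - 1) ^ (2 * d + 1) ∣ X ^ k * P - Q) : P.eval 1 ≠ 0 := by
  obtain ⟨hP0, hQ0⟩ := pade_ne_zero h0 hP hQ h
  obtain ⟨P₁, hP₁, hndvd⟩ := exists_eq_pow_rootMultiplicity_mul_and_not_dvd P hP0 1
  set j := P.rootMultiplicity 1
  rw [C_1] at hP₁
  have hP₁0 : P₁ ≠ 0 := by rintro rfl; simp at hndvd
  have hmonic : ((X - 1 : ℝ[X]) ^ j).Monic := (monic_X_sub_C 1).pow _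
  have hX : ((X - 1 : ℝ[X]) ^ j).natDegree = j := by
    rw [← C_1, natDegree_pow, natDegree_X_sub_C, mul_one]
  have hdegP : j + P₁.natDegree ≤ d := by
    rwa [hP₁, hmonic.natDegree_mul' hP₁0, hX] at hP
  obtain ⟨W, hW⟩ := h
  have hsplit : (X - 1 : ℝ[X]) ^ (2 * d + 1) = (X - 1) ^ j * (X - 1) ^ (2 * d - j + 1) := by
    rw [← pow_add]; congr 1; omega
  set Q₁ := X ^ k * P₁ - (X - 1) ^ (2 * d - j + 1) * W with hQ₁
  have hQeq : Q = (X - 1) ^ j * Q₁ := by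
    rw [hQ₁]
    linear_combination -hW + X ^ k * hP₁ - W * hsplit
  have hQ₁0 : Q₁ ≠ 0 := by intro h; rw [h, mul_zero] at hQeq; exact hQ0 hQeq
  have hdegQ : j + Q₁.natDegree ≤ d := by
    rwa [hQeq, hmonic.natDegree_mul' hQ₁0, hX] at hQ
  have hle := le_two_mul_of_pow_dvd (k := k) (d := d - j) (m := 2 * d - j) (by omega) hP₁0 hQ₁0
    (by omega) (by omega) ⟨W, by rw [hQ₁]; ring⟩
  have hj : j = 0 := by omega
  intro hroot
  have : 0 < P.rootMultiplicity 1 := (rootMultiplicity_pos hP0).2 hroot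
  omega

open Polynomial in
theorem eval_one_eq_of_dvd {k d : ℕ} {P Q : ℝ[X]}
    (h : (X - 1) ^ (2 * d + 1) ∣ X ^ k * P - Q) : Q.eval 1 = P.eval 1 := by
  obtain ⟨W, hW⟩ := h
  have := congrArg (eval 1) hW
  simp at this
  linarith

open Polynomial Set in
/-- If `log (Q / (z ^ k P))` is a Padé error term near `1`, it is strictly superadditive in
`log z`, so it cannot satisfy `L(zw) = L(z) + L(w)`. -/
theorem not_multiplicative_pade {k d : ℕ} (hd : 1 ≤ d) (hdk : d < k) {P Q : ℝ[X]}
    (h0 : ¬ (P = 0 ∧ Q = 0)) (hP : P.natDegree ≤ d) (hQ : Q.natDegree ≤ d)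
    (h : (X - 1) ^ (2 * d + 1) ∣ X ^ k * P - Q) :
    ∃ c₀ : ℝ, 0 < c₀ ∧ ∀ z w s t : ℝ, 1 < z → 1 < w → z * w ≤ 1 + c₀ → 0 < s → 0 < t →
      s * (z ^ k * P.eval z) = Q.eval z → t * (w ^ k * P.eval w) = Q.eval w →
      s * t * ((z * w) ^ k * P.eval (z * w)) = Q.eval (z * w) → False := by
  obtain ⟨hP0, hQ0⟩ := pade_ne_zero h0 hP hQ h
  have hP1 := eval_one_pade_ne_zero hdk h0 hP hQ h
  have hQP := eval_one_eq_of_dvd h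
  obtain ⟨c, hc, hN⟩ := logDerivNumerator_eq_C_mul hdk hP0 hQ0 hP hQ h
  set g : ℝ[X] := P * Q with hg
  have hev : ∀ᶠ z in nhds (1 : ℝ), 0 < g.eval z ∧
      0 < 2 * d * g.eval z - (z - 1) * (derivative g).eval z := by
    have hpos : 0 < g.eval 1 := by
      rw [hg, eval_mul, hQP]
      exact mul_self_pos.2 hP1
    have hd' : (0 : ℝ) < d := by exact_mod_cast hd
    refine Filter.Eventually.and ?_ ?_
    · exact (g.continuous.continuousAt (x := (1 : ℝ))).eventually (lt_mem_nhds hpos)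
    · have hcont : Continuous fun z : ℝ => 2 * d * g.eval z - (z - 1) * (derivative g).eval z := by
        fun_prop
      refine (hcont.continuousAt (x := (1 : ℝ))).eventually (lt_mem_nhds ?_)
      simp only [sub_self, zero_mul, sub_zero]
      positivity
  obtain ⟨r, hr, hball⟩ := Metric.eventually_nhds_iff.1 hev
  refine ⟨r / 2, by positivity, ?_⟩
  have hgood : ∀ z : ℝ, 1 ≤ z → z ≤ 1 + r / 2 → 0 < g.eval z ∧
      0 < 2 * d * g.eval z - (z - 1) * (derivative g).eval z := by
    intro z h1 h2
    apply hball
    rw [Real.dist_eq, abs_of_nonneg (by linarith)]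
    linarith
  have hPne : ∀ z : ℝ, 1 ≤ z → z ≤ 1 + r / 2 → P.eval z ≠ 0 ∧ Q.eval z ≠ 0 := by
    intro z h1 h2
    have := (hgood z h1 h2).1.ne'
    rw [hg, eval_mul] at this
    exact ⟨left_ne_zero_of_mul this, right_ne_zero_of_mul this⟩
  have hinj : ∀ x y : ℝ, 1 ≤ x → x < y → y ≤ 1 + r / 2 →
      (x - 1) ^ (2 * d) / g.eval x ≠ (y - 1) ^ (2 * d) / g.eval y := by
    intro x y hx hxy hy heq
    have hder : ∀ u : ℝ, 1 ≤ u → u ≤ 1 + r / 2 →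
        HasDerivAt (fun u : ℝ => (u - 1) ^ (2 * d) / g.eval u)
          ((((2 * d : ℕ) * (u - 1) ^ (2 * d - 1) * 1) * g.eval u
            - (u - 1) ^ (2 * d) * (derivative g).eval u) / (g.eval u) ^ 2) u := by
      intro u h1 h2
      exact (((hasDerivAt_id u).sub_const 1).pow (2 * d)).div (g.hasDerivAt u) (hgood u h1 h2).1.ne'
    obtain ⟨u, hu, hu0⟩ := exists_hasDerivAt_eq_zero hxy
      (fun u hu => (hder u (hx.trans hu.1) (hu.2.trans hy)).continuousAt.continuousWithinAt) heq
      (fun u hu => hder u (hx.trans hu.1.le) (hu.2.le.trans hy))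
    obtain ⟨hg0, hg1⟩ := hgood u (hx.trans hu.1.le) (hu.2.le.trans hy)
    have hu1 : 0 < u - 1 := by linarith [hu.1]
    rw [div_eq_zero_iff, or_iff_left (by positivity)] at hu0
    have hpow : (u - 1) ^ (2 * d) = (u - 1) ^ (2 * d - 1) * (u - 1) := by
      rw [← pow_succ]; congr 1; omega
    have : (u - 1) ^ (2 * d - 1) * (2 * d * g.eval u - (u - 1) * (derivative g).eval u) = 0 := by
      rw [hpow] at hu0
      push_cast at hu0
      linear_combination hu0
    have h3 : 0 < (u - 1) ^ (2 * d - 1) * (2 * d * g.eval u - (u - 1) * (derivative g).eval u) := by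
      positivity
    linarith
  set L : ℝ → ℝ := fun z => Real.log (Q.eval z) - Real.log (P.eval z) - k * Real.log z with hL
  have hLder : ∀ z : ℝ, 1 ≤ z → z ≤ 1 + r / 2 →
      HasDerivAt L (c / z * ((z - 1) ^ (2 * d) / g.eval z)) z := by
    intro z h1 h2
    obtain ⟨hPz, hQz⟩ := hPne z h1 h2
    have hz : z ≠ 0 := by positivity
    have hd1 := (((Q.hasDerivAt z).log hQz).sub ((P.hasDerivAt z).log hPz)).sub
      ((Real.hasDerivAt_log hz).const_mul (k : ℝ))
    refine hd1.congr_deriv ?_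
    have hNz := congrArg (eval z) hN
    simp only [logDerivNumerator, eval_sub, eval_mul, eval_X, eval_natCast, eval_C, eval_pow,
      eval_one] at hNz
    rw [hg, eval_mul]
    field_simp
    linear_combination hNz
  have hLval : ∀ z s : ℝ, 1 ≤ z → z ≤ 1 + r / 2 → 0 < s → s * (z ^ k * P.eval z) = Q.eval z →
      L z = Real.log s := by
    intro z s h1 h2 hs heq
    obtain ⟨hPz, hQz⟩ := hPne z h1 h2
    have hz : z ^ k ≠ 0 := by positivity
    simp only [hL]
    rw [← heq, Real.log_mul hs.ne' (mul_ne_zero hz hPz), Real.log_mul hz hPz, Real.log_pow]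
    ring
  intro z w s t hz hw hzw hs ht h1 h2 h3
  have hz' : z ≤ 1 + r / 2 := by nlinarith
  have hw' : w ≤ 1 + r / 2 := by nlinarith
  have e1 := hLval z s hz.le hz' hs h1
  have e2 := hLval w t hw.le hw' ht h2
  have e3 := hLval (z * w) (s * t) (by nlinarith) hzw (mul_pos hs ht) h3
  rw [Real.log_mul hs.ne' ht.ne'] at e3
  have hL1 : L 1 = 0 := by simp [hL, hQP]
  have hder : ∀ x : ℝ, 1 ≤ x → x ≤ z → HasDerivAt (fun x => L (x * w) - L x)
      (c / (x * w) * ((x * w - 1) ^ (2 * d) / g.eval (x * w)) * w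
        - c / x * ((x - 1) ^ (2 * d) / g.eval x)) x := by
    intro x hx1 hxz
    have hxw : x * w ≤ 1 + r / 2 := (by nlinarith : x * w ≤ z * w).trans hzw
    refine HasDerivAt.sub ?_ (hLder x hx1 (by linarith))
    exact HasDerivAt.comp x (hLder (x * w) (by nlinarith) hxw) (hasDerivAt_mul_const w)
  obtain ⟨x, hx, hx0⟩ := exists_hasDerivAt_eq_zero (f := fun x => L (x * w) - L x) hz
    (fun x hx => (hder x hx.1 hx.2).continuousAt.continuousWithinAt)
    (by simp only [one_mul, hL1]; linarith)
    (fun x hx => hder x hx.1.le hx.2.le)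
  refine hinj x (x * w) hx.1.le (by nlinarith [hx.1])
    ((by nlinarith [hx.2] : x * w ≤ z * w).trans hzw) ?_
  have hxpos : 0 < x := by linarith [hx.1]
  have hcx : c / x ≠ 0 := div_ne_zero hc hxpos.ne'
  have hrw : c / (x * w) * ((x * w - 1) ^ (2 * d) / g.eval (x * w)) * w
      = c / x * ((x * w - 1) ^ (2 * d) / g.eval (x * w)) := by
    field_simp
  rw [hrw, ← mul_sub] at hx0
  linarith [(mul_eq_zero.1 hx0).resolve_left hcx]

open Polynomial Set in
theorem exists_pade_bound {k d : ℕ} {P Q : ℝ[X]}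
    (h : (X - 1) ^ (2 * d + 1) ∣ X ^ k * P - Q) :
    ∃ C : ℝ, 1 ≤ C ∧ ∀ z ∈ Icc (1 : ℝ) 2, |z ^ k * P.eval z| ≤ C ∧ |Q.eval z| ≤ C ∧
      |z ^ k * P.eval z - Q.eval z| ≤ C * (z - 1) ^ (2 * d + 1) := by
  obtain ⟨W, hW⟩ := h
  have hb (F : ℝ[X]) : ∃ C, ∀ z ∈ Icc (1 : ℝ) 2, |F.eval z| ≤ C :=
    isCompact_Icc.exists_bound_of_continuousOn F.continuous.continuousOn
  obtain ⟨C₁, h₁⟩ := hb (X ^ k * P)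
  obtain ⟨C₂, h₂⟩ := hb Q
  obtain ⟨C₃, h₃⟩ := hb W
  refine ⟨max 1 (max C₁ (max C₂ C₃)), le_max_left _ _, fun z hz => ⟨?_, ?_, ?_⟩⟩
  · have := h₁ z hz
    simp only [eval_mul, eval_pow, eval_X] at this
    exact this.trans (by simp)
  · exact (h₂ z hz).trans (by simp)
  · have := congrArg (eval z) hW
    simp only [eval_sub, eval_mul, eval_pow, eval_X, eval_one] at this
    have hz1 : 0 ≤ z - 1 := by linarith [hz.1]
    rw [this, abs_mul, abs_of_nonneg (pow_nonneg hz1 _), mul_comm]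
    exact mul_le_mul_of_nonneg_right ((h₃ z hz).trans (by simp)) (pow_nonneg hz1 _)

open Polynomial in
theorem exists_int_eq_pow_mul_eval {d : ℕ} {P : ℤ[X]} (hP : P.natDegree ≤ d) (x : ℕ) {y : ℕ}
    (hy : 0 < y) :
    ∃ m : ℤ, (m : ℝ) = (y : ℝ) ^ d * (P.map (Int.castRingHom ℝ)).eval ((x : ℝ) / y) := by
  refine ⟨∑ i ∈ Finset.range (d + 1), P.coeff i * x ^ i * y ^ (d - i), ?_⟩
  have hy' : (y : ℝ) ≠ 0 := by exact_mod_cast hy.ne'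
  rw [eval_eq_sum_range' (n := d + 1) (by have := natDegree_map_le (f := Int.castRingHom ℝ) (p := P); omega),
    Finset.mul_sum]
  push_cast
  refine Finset.sum_congr rfl fun i hi => ?_
  have hi' : i ≤ d := by have := Finset.mem_range.1 hi; omega
  have hpow : (y : ℝ) ^ d = y ^ i * y ^ (d - i) := by rw [← pow_add]; congr 1; omega
  rw [coeff_map, hpow, div_pow]
  simp only [eq_intCast]
  field_simp

open Polynomial in
/-- An integer built from two pairs of consecutive integers with large `k`-th power divisors;
if it is small, it must vanish. -/
theorem pade_form_eq_zero {k d : ℕ} {P Q : ℤ[X]} (hP : P.natDegree ≤ d) (hQ : Q.natDegree ≤ d)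
    {a₁ b₁ n₁ a₂ b₂ n₂ : ℕ} (ha₁ : 0 < a₁) (hb₁ : 0 < b₁) (ha₂ : 0 < a₂) (hb₂ : 0 < b₂)
    (han₁ : a₁ ^ k ∣ n₁) (hbn₁ : b₁ ^ k ∣ n₁ + 1) (han₂ : a₂ ^ k ∣ n₂) (hbn₂ : b₂ ^ k ∣ n₂ + 1)
    {z F : ℝ} (hz : z = (a₁ * b₂ : ℕ) / (a₂ * b₁ : ℕ))
    (hF : F = n₂ * (n₁ + 1) * (z ^ k * (P.map (Int.castRingHom ℝ)).eval z)
      - n₁ * (n₂ + 1) * (Q.map (Int.castRingHom ℝ)).eval z)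
    (hlt : |F| * ((a₂ * b₁ : ℕ) : ℝ) ^ d < ((a₂ * b₁ : ℕ) : ℝ) ^ k * z ^ k) : F = 0 := by
  have hy : 0 < a₂ * b₁ := by positivity
  obtain ⟨m₁, hm₁⟩ := exists_int_eq_pow_mul_eval hP (a₁ * b₂) hy
  obtain ⟨m₂, hm₂⟩ := exists_int_eq_pow_mul_eval hQ (a₁ * b₂) hy
  rw [← hz] at hm₁ hm₂
  obtain ⟨u₁, hu₁⟩ := han₁
  obtain ⟨v₁, hv₁⟩ := hbn₁
  obtain ⟨u₂, hu₂⟩ := han₂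
  obtain ⟨v₂, hv₂⟩ := hbn₂
  set y : ℝ := ((a₂ * b₁ : ℕ) : ℝ) with hydef
  have hypos : 0 < y := Nat.cast_pos.2 hy
  have hzy : y * z = (a₁ * b₂ : ℕ) := by rw [hz]; field_simp
  have hzpos : 0 < z := by
    rw [hz]; exact div_pos (by exact_mod_cast (by positivity : 0 < a₁ * b₂)) hypos
  have e1 : (n₂ : ℝ) * (n₁ + 1) = y ^ k * (u₂ * v₁) := by
    have h1 : ((n₁ : ℝ) + 1) = b₁ ^ k * v₁ := by exact_mod_cast hv₁
    have h2 : (n₂ : ℝ) = a₂ ^ k * u₂ := by exact_mod_cast hu₂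
    rw [h1, h2, hydef]; push_cast; ring
  have e2 : (n₁ : ℝ) * (n₂ + 1) = y ^ k * z ^ k * (u₁ * v₂) := by
    have h1 : ((n₂ : ℝ) + 1) = b₂ ^ k * v₂ := by exact_mod_cast hv₂
    have h2 : (n₁ : ℝ) = a₁ ^ k * u₁ := by exact_mod_cast hu₁
    rw [← mul_pow, hzy, h1, h2]; push_cast; ring
  have hE : ((u₂ * v₁ * m₁ - u₁ * v₂ * m₂ : ℤ) : ℝ) * (y ^ k * z ^ k) = y ^ d * F := by
    push_cast
    rw [hF, e1, e2, hm₁, hm₂]; ring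
  have hpos : 0 < y ^ k * z ^ k := by positivity
  have hE0 : (u₂ * v₁ * m₁ - u₁ * v₂ * m₂ : ℤ) = 0 := by
    rw [← Int.abs_lt_one_iff]
    have : |((u₂ * v₁ * m₁ - u₁ * v₂ * m₂ : ℤ) : ℝ)| * (y ^ k * z ^ k) < 1 * (y ^ k * z ^ k) := by
      rw [← abs_of_pos hpos, ← abs_mul, hE, abs_of_pos hpos, abs_mul,
        abs_of_pos (pow_pos hypos d), one_mul, mul_comm]
      exact hlt
    exact_mod_cast lt_of_mul_lt_mul_right this hpos.le
  rw [hE0, Int.cast_zero, zero_mul] at hE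
  exact (mul_eq_zero.1 hE.symm).resolve_left (by positivity)

/-- `n ∈ (Z, 2Z]` with `a ^ k ∣ n`, `b ^ k ∣ n + 1` and `ab > Y`. -/
structure IsTwinPoint (k : ℕ) (Z Y : ℝ) (a b n : ℕ) : Prop where
  a_pos : 0 < a
  b_pos : 0 < b
  lt_n : Z < n
  n_le : (n : ℝ) ≤ 2 * Z
  a_dvd : a ^ k ∣ n
  b_dvd : b ^ k ∣ n + 1
  lt_ab : Y < a * b

open Polynomial Set in
theorem pade_form_eq_zero_of_close {k d : ℕ} (hk : 0 < k) (hd₁ : 2 * k ≤ 7 * (d + 1))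
    (hd₂ : 7 * d ≤ 2 * k) {P Q : ℤ[X]} (hP : P.natDegree ≤ d) (hQ : Q.natDegree ≤ d)
    (h : (X - 1) ^ (2 * d + 1) ∣ X ^ k * P - Q) :
    ∃ c Z₀ : ℝ, 0 < c ∧ c ≤ 1 ∧ 1 ≤ Z₀ ∧ ∀ Z Y : ℝ, Z₀ ≤ Z → Y = Z ^ (14 / (9 * (k : ℝ))) →
      ∀ a₁ b₁ n₁ a₂ b₂ n₂ : ℕ, IsTwinPoint k Z Y a₁ b₁ n₁ → IsTwinPoint k Z Y a₂ b₂ n₂ →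
      ∀ z : ℝ, z = (a₁ * b₂ : ℕ) / (a₂ * b₁ : ℕ) → 1 ≤ z → z ≤ 1 + c / Y →
      n₂ * (n₁ + 1) * (z ^ k * (P.map (Int.castRingHom ℝ)).eval z)
        = n₁ * (n₂ + 1) * (Q.map (Int.castRingHom ℝ)).eval z := by
  set p := P.map (Int.castRingHom ℝ)
  set q := Q.map (Int.castRingHom ℝ)
  have hdvd : (X - 1 : ℝ[X]) ^ (2 * d + 1) ∣ X ^ k * p - q := by
    have := map_dvd (mapRingHom (Int.castRingHom ℝ)) h
    simpa using this
  obtain ⟨C, hC1, hC⟩ := exists_pade_bound hdvd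
  set B : ℝ := 16 * C * 2 ^ k with hB
  have h2k : (1 : ℝ) ≤ 2 ^ k := one_le_pow₀ one_le_two
  have hB1 : 1 ≤ B := by
    rw [hB]; nlinarith
  refine ⟨1 / B, B ^ (9 : ℕ), by positivity, by rw [div_le_one (by positivity)]; exact hB1,
    one_le_pow₀ hB1, ?_⟩
  intro Z Y hZ hY a₁ b₁ n₁ a₂ b₂ n₂ h₁ h₂ z hz hz1 hz2
  have hZ1 : 1 ≤ Z := (one_le_pow₀ hB1).trans hZ
  have hZpos : 0 < Z := by linarith
  have hkR : (0 : ℝ) < k := by exact_mod_cast hk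
  have hY1 : 1 ≤ Y := by rw [hY]; exact Real.one_le_rpow hZ1 (by positivity)
  have hYpos : 0 < Y := by linarith
  have hYpow (m : ℕ) : Y ^ m = Z ^ (14 / (9 * (k : ℝ)) * m) := by
    rw [hY, ← Real.rpow_natCast, ← Real.rpow_mul hZpos.le]
  have hA : Z ^ 2 ≤ Y ^ (2 * d + 1) * Y ^ (k - d) := by
    rw [← pow_add, hYpow, ← Real.rpow_natCast]
    apply Real.rpow_le_rpow_of_exponent_le hZ1
    rw [div_mul_eq_mul_div, le_div_iff₀ (by positivity)]
    have : 2 * (9 * k) ≤ 14 * (2 * d + 1 + (k - d)) := by omega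
    exact_mod_cast this
  have hBZ : B * Z ≤ Y ^ (k - d) := by
    have h1 : B ≤ Z ^ (1 / 9 : ℝ) := by
      calc B = (B ^ (9 : ℕ)) ^ (1 / 9 : ℝ) := by
            rw [← Real.rpow_natCast, ← Real.rpow_mul (by positivity)]; norm_num
        _ ≤ _ := Real.rpow_le_rpow (by positivity) hZ (by norm_num)
    calc B * Z ≤ Z ^ (1 / 9 : ℝ) * Z ^ (1 : ℝ) := by rw [Real.rpow_one]; gcongr
      _ = Z ^ (10 / 9 : ℝ) := by rw [← Real.rpow_add hZpos]; norm_num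
      _ ≤ Y ^ (k - d) := by
        rw [hYpow]
        apply Real.rpow_le_rpow_of_exponent_le hZ1
        rw [div_mul_eq_mul_div, div_le_div_iff₀ (by norm_num) (by positivity)]
        have : 10 * (9 * k) ≤ 14 * (k - d) * 9 := by omega
        exact_mod_cast this
  have hcY : 1 / B / Y ≤ 1 := by
    rw [div_div, div_le_one (by positivity)]; nlinarith
  obtain ⟨hb1, hb2, hb3⟩ := hC z ⟨hz1, by linarith⟩
  set y : ℝ := ((a₂ * b₁ : ℕ) : ℝ) with hy
  have hypos : 0 < y := by
    rw [hy]; exact_mod_cast Nat.mul_pos h₂.a_pos h₁.b_pos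
  have hzy : y * z = (a₁ * b₂ : ℕ) := by rw [hz]; field_simp
  have hyY : Y / 2 ≤ y := by
    by_contra! hlt
    have h3 : Y * Y < (a₁ * b₁ : ℝ) * (a₂ * b₂) := by
      apply mul_lt_mul'' h₁.lt_ab h₂.lt_ab hYpos.le hYpos.le
    have h4 : (a₁ * b₁ : ℝ) * (a₂ * b₂) = y * (y * z) := by
      rw [hzy, hy]; push_cast; ring
    have h5 : y * (y * z) ≤ (Y / 2) * (Y / 2 * 2) := by
      gcongr
      linarith
    nlinarith
  set F : ℝ := n₂ * (n₁ + 1) * (z ^ k * p.eval z) - n₁ * (n₂ + 1) * q.eval z with hF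
  have hFle : |F| ≤ 8 * C / B * Y ^ (k - d) := by
    have hFeq : F = n₁ * n₂ * (z ^ k * p.eval z - q.eval z) + n₂ * (z ^ k * p.eval z)
        - n₁ * q.eval z := by rw [hF]; ring
    have hn₁ := h₁.n_le
    have hn₂ := h₂.n_le
    have hpow : (z - 1) ^ (2 * d + 1) ≤ 1 / B * (1 / Y ^ (2 * d + 1)) := by
      calc (z - 1) ^ (2 * d + 1) ≤ (1 / B / Y) ^ (2 * d + 1) :=
            pow_le_pow_left₀ (by linarith) (by linarith) _
        _ = (1 / B) ^ (2 * d + 1) * (1 / Y ^ (2 * d + 1)) := by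
            rw [div_pow, div_eq_mul_one_div]
        _ ≤ 1 / B * (1 / Y ^ (2 * d + 1)) := by
            gcongr
            exact pow_le_of_le_one (by positivity)
              (by rw [div_le_one (by positivity)]; exact hB1) (by omega)
    have hmain : |(n₁ * n₂ * (z ^ k * p.eval z - q.eval z) : ℝ)| ≤ 4 * C / B * Y ^ (k - d) := by
      rw [abs_mul, abs_of_nonneg (by positivity : (0 : ℝ) ≤ n₁ * n₂)]
      calc (n₁ * n₂ : ℝ) * |z ^ k * p.eval z - q.eval z|
          ≤ (2 * Z) * (2 * Z) * (C * (1 / B * (1 / Y ^ (2 * d + 1)))) := by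
            gcongr
            exact hb3.trans (by gcongr)
        _ = 4 * C / B * (Z ^ 2 / Y ^ (2 * d + 1)) := by field_simp; ring
        _ ≤ 4 * C / B * Y ^ (k - d) := by
            gcongr
            rw [div_le_iff₀ (by positivity), mul_comm]
            exact hA
    have hZle : Z ≤ Y ^ (k - d) / B := by
      rw [le_div_iff₀ (by positivity), mul_comm]; exact hBZ
    have hs2 : |(n₂ * (z ^ k * p.eval z) : ℝ)| ≤ 2 * (Y ^ (k - d) / B) * C := by
      rw [abs_mul, abs_of_nonneg (by positivity : (0 : ℝ) ≤ n₂)]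
      gcongr
      linarith
    have hs3 : |(n₁ * q.eval z : ℝ)| ≤ 2 * (Y ^ (k - d) / B) * C := by
      rw [abs_mul, abs_of_nonneg (by positivity : (0 : ℝ) ≤ n₁)]
      gcongr
      linarith
    rw [hFeq]
    have hsum : 8 * C / B * Y ^ (k - d) = 4 * C / B * Y ^ (k - d)
        + 2 * (Y ^ (k - d) / B) * C + 2 * (Y ^ (k - d) / B) * C := by ring
    rw [abs_le] at hmain hs2 hs3 ⊢
    constructor <;> linarith [hmain.1, hmain.2, hs2.1, hs2.2, hs3.1, hs3.2]
  have hFlt : |F| < y ^ (k - d) := by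
    calc |F| ≤ 8 * C / B * Y ^ (k - d) := hFle
      _ = (1 / 2) * ((1 / 2) ^ k * Y ^ (k - d)) := by
        rw [hB, one_div_pow]; field_simp; norm_num
      _ < (1 / 2) ^ k * Y ^ (k - d) := by
        have : 0 < (1 / 2 : ℝ) ^ k * Y ^ (k - d) := by positivity
        linarith
      _ ≤ (1 / 2) ^ (k - d) * Y ^ (k - d) := by
        gcongr ?_ * _
        exact pow_le_pow_of_le_one (by norm_num) (by norm_num) (by omega)
      _ = (Y / 2) ^ (k - d) := by rw [← mul_pow]; ring
      _ ≤ y ^ (k - d) := by gcongr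
  have := pade_form_eq_zero hP hQ h₁.a_pos h₁.b_pos h₂.a_pos h₂.b_pos h₁.a_dvd h₁.b_dvd
    h₂.a_dvd h₂.b_dvd hz hF (by
      calc |F| * y ^ d < y ^ (k - d) * y ^ d := by gcongr
        _ = y ^ k := by rw [← pow_add]; congr 1; omega
        _ ≤ y ^ k * z ^ k := le_mul_of_one_le_right (by positivity) (one_le_pow₀ hz1))
  rw [hF] at this
  linarith

theorem IsTwinPoint.coprime {k : ℕ} (hk : 0 < k) {Z Y : ℝ} {a b n : ℕ}
    (h : IsTwinPoint k Z Y a b n) : a.Coprime b := by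
  have h1 : (a ^ k).Coprime (b ^ k) :=
    Nat.Coprime.coprime_dvd_left h.a_dvd (Nat.Coprime.coprime_dvd_right h.b_dvd (by simp))
  exact (Nat.coprime_pow_left_iff hk _ _).1 ((Nat.coprime_pow_right_iff hk _ _).1 h1)

theorem IsTwinPoint.eq_of_mul_eq {k : ℕ} (hk : 0 < k) {Z Y : ℝ} (hY : 0 ≤ Y)
    (hYk : Z ≤ Y ^ k) {a₁ b₁ n₁ a₂ b₂ n₂ : ℕ} (h₁ : IsTwinPoint k Z Y a₁ b₁ n₁)
    (h₂ : IsTwinPoint k Z Y a₂ b₂ n₂) (h : a₁ * b₂ = a₂ * b₁) :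
    a₁ = a₂ ∧ b₁ = b₂ ∧ n₁ = n₂ := by
  have ha : a₁ = a₂ := Nat.dvd_antisymm
    ((h₁.coprime hk).dvd_of_dvd_mul_right (h ▸ dvd_mul_right _ _))
    ((h₂.coprime hk).dvd_of_dvd_mul_right (h ▸ dvd_mul_right _ _))
  subst ha
  have hb : b₁ = b₂ := (Nat.eq_of_mul_eq_mul_left h₁.a_pos h).symm
  subst hb
  refine ⟨rfl, rfl, ?_⟩
  have key : ∀ n m : ℕ, IsTwinPoint k Z Y a₁ b₁ n → IsTwinPoint k Z Y a₁ b₁ m → n ≤ m → n = m := by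
    intro n m hn hm hle
    have hdvd : a₁ ^ k * b₁ ^ k ∣ m - n := by
      refine ((hn.coprime hk).pow k k).mul_dvd_of_dvd_of_dvd (Nat.dvd_sub hm.a_dvd hn.a_dvd) ?_
      have := Nat.dvd_sub hm.b_dvd hn.b_dvd
      rwa [Nat.add_sub_add_right] at this
    have hlt : m - n < a₁ ^ k * b₁ ^ k := by
      have h1 : (m : ℝ) - n < (a₁ ^ k * b₁ ^ k : ℕ) := by
        calc (m : ℝ) - n < Z := by linarith [hn.lt_n, hm.n_le]
          _ ≤ Y ^ k := hYk
          _ ≤ (a₁ * b₁ : ℝ) ^ k := pow_le_pow_left₀ hY hn.lt_ab.le k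
          _ = _ := by push_cast; ring
      rw [← Nat.cast_sub hle] at h1
      exact_mod_cast h1
    have := Nat.eq_zero_of_dvd_of_lt hdvd hlt
    omega
  rcases le_total n₁ n₂ with hle | hle
  · exact key _ _ h₁ h₂ hle
  · exact (key _ _ h₂ h₁ hle).symm

theorem IsTwinPoint.mul_pow_ne {k : ℕ} (hk : 2 ≤ k) {Z Y : ℝ}
    {a₁ b₁ n₁ a₂ b₂ n₂ : ℕ} (h₁ : IsTwinPoint k Z Y a₁ b₁ n₁)
    (h₂ : IsTwinPoint k Z Y a₂ b₂ n₂) (h : a₂ * b₁ < a₁ * b₂) :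
    n₂ * (n₁ + 1) * (a₁ * b₂) ^ k ≠ n₁ * (n₂ + 1) * (a₂ * b₁) ^ k := by
  intro heq
  have hn₂ : n₁ < 2 * n₂ := by
    have : (n₁ : ℝ) < 2 * n₂ := by linarith [h₁.n_le, h₂.lt_n]
    exact_mod_cast this
  have hn₂pos : 0 < n₂ := by omega
  have hdvd : (a₂ * b₁) ^ k ∣ n₂ * (n₁ + 1) := by
    rw [mul_pow]; exact mul_dvd_mul h₂.a_dvd h₁.b_dvd
  set x := a₁ * b₂
  set y := a₂ * b₁ with hy
  have hypos : 0 < y := Nat.mul_pos h₂.a_pos h₁.b_pos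
  have hy2 : y ^ 2 ≤ n₂ * (n₁ + 1) :=
    (Nat.pow_le_pow_right hypos hk).trans (Nat.le_of_dvd (Nat.mul_pos hn₂pos n₁.succ_pos) hdvd)
  have hx : y ^ k * (y + 2) ≤ y * x ^ k := by
    obtain ⟨j, rfl⟩ := Nat.exists_eq_add_of_le hk
    calc y ^ (2 + j) * (y + 2) = y * (y ^ j * (y ^ 2 + 2 * y)) := by ring
      _ ≤ y * ((y + 1) ^ j * (y + 1) ^ 2) := by gcongr <;> nlinarith
      _ = y * (y + 1) ^ (2 + j) := by ring
      _ ≤ y * x ^ (2 + j) := by gcongr; omega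
  have h3 : n₂ * (n₁ + 1) * (y + 2) ≤ n₁ * (n₂ + 1) * y := by
    refine Nat.le_of_mul_le_mul_left ?_ (pow_pos hypos k)
    calc y ^ k * (n₂ * (n₁ + 1) * (y + 2)) = n₂ * (n₁ + 1) * (y ^ k * (y + 2)) := by ring
      _ ≤ n₂ * (n₁ + 1) * (y * x ^ k) := by gcongr
      _ = y * (n₂ * (n₁ + 1) * x ^ k) := by ring
      _ = y ^ k * (n₁ * (n₂ + 1) * y) := by rw [heq]; ring
  have h4 : y * n₂ + 2 * n₂ * (n₁ + 1) ≤ y * n₁ := by nlinarith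
  have h5 : n₂ < n₁ := by
    have : y * n₂ < y * n₁ := by nlinarith
    exact lt_of_mul_lt_mul_left this (Nat.zero_le _)
  have h6 : 2 * (n₁ + 1) < y := by
    have h7 : n₂ * (2 * (n₁ + 1)) < n₂ * y := by nlinarith
    exact lt_of_mul_lt_mul_left h7 (Nat.zero_le _)
  nlinarith

open Polynomial in
/-- Three twin points cannot have nearly equal ratios `a / b`. -/
theorem not_three_twinPoints_close {k : ℕ} (hk : 2 ≤ k) :
    ∃ c Z₀ : ℝ, 0 < c ∧ c ≤ 1 ∧ 1 ≤ Z₀ ∧ ∀ Z Y : ℝ, Z₀ ≤ Z → Y = Z ^ (14 / (9 * (k : ℝ))) →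
      ∀ a₁ b₁ n₁ a₂ b₂ n₂ a₃ b₃ n₃ : ℕ, IsTwinPoint k Z Y a₁ b₁ n₁ →
      IsTwinPoint k Z Y a₂ b₂ n₂ → IsTwinPoint k Z Y a₃ b₃ n₃ →
      a₂ * b₁ < a₁ * b₂ → a₃ * b₂ < a₂ * b₃ →
      ((a₁ * b₃ : ℕ) / (a₃ * b₁ : ℕ) : ℝ) ≤ 1 + c / Y → False := by
  have one_lt : ∀ {x y : ℕ}, 0 < x → x < y → (1 : ℝ) < (y : ℝ) / x := by
    intro x y hx hxy
    rw [one_lt_div (by exact_mod_cast hx)]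
    exact_mod_cast hxy
  have ratio_mul : ∀ {a₁ b₁ a₂ b₂ a₃ b₃ : ℕ}, 0 < b₁ → 0 < a₂ → 0 < b₂ → 0 < a₃ →
      ((a₁ * b₃ : ℕ) / (a₃ * b₁ : ℕ) : ℝ)
        = ((a₁ * b₂ : ℕ) / (a₂ * b₁ : ℕ) : ℝ) * ((a₂ * b₃ : ℕ) / (a₃ * b₂ : ℕ) : ℝ) := by
    intro a₁ b₁ a₂ b₂ a₃ b₃ h1 h2 h3 h4
    push_cast
    field_simp
  have one_le_Y : ∀ {Z Y : ℝ}, 1 ≤ Z → Y = Z ^ (14 / (9 * (k : ℝ))) → 1 ≤ Y := by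
    rintro Z Y hZ rfl
    exact Real.one_le_rpow hZ (by positivity)
  by_cases hd : 2 * k < 7
  · obtain ⟨c, Z₀, hc, hc1, hZ₀, H⟩ := pade_form_eq_zero_of_close (k := k) (d := 0) (P := 1) (Q := 1)
      (by omega) (by omega) (by omega) (by simp) (by simp)
      (by simpa using sub_dvd_pow_sub_pow (X : ℤ[X]) 1 k)
    refine ⟨c, Z₀, hc, hc1, hZ₀, ?_⟩
    intro Z Y hZ hY a₁ b₁ n₁ a₂ b₂ n₂ a₃ b₃ n₃ h₁ h₂ h₃ h12 h23 hle
    have hz12 := one_lt (Nat.mul_pos h₂.a_pos h₁.b_pos) h12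
    have hz23 := one_lt (Nat.mul_pos h₃.a_pos h₂.b_pos) h23
    rw [ratio_mul h₁.b_pos h₂.a_pos h₂.b_pos h₃.a_pos] at hle
    have hF := H Z Y hZ hY a₁ b₁ n₁ a₂ b₂ n₂ h₁ h₂ _ rfl hz12.le (by nlinarith)
    refine h₁.mul_pow_ne hk h₂ h12 ?_
    have hypos : ((a₂ * b₁ : ℕ) : ℝ) ≠ 0 := by
      exact_mod_cast (Nat.mul_pos h₂.a_pos h₁.b_pos).ne'
    simp only [Polynomial.map_one, eval_one, mul_one, div_pow] at hF
    rw [← mul_div_assoc, div_eq_iff (pow_ne_zero _ hypos)] at hF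
    exact_mod_cast hF
  · set d := 2 * k / 7 with hdd
    obtain ⟨P, Q, h0, hP, hQ, hdvd⟩ := exists_pade_pair k d
    have hinj : Function.Injective (Int.castRingHom ℝ) := Int.cast_injective
    obtain ⟨c₀, hc₀, hno⟩ := not_multiplicative_pade (k := k) (d := d)
      (P := P.map (Int.castRingHom ℝ)) (Q := Q.map (Int.castRingHom ℝ)) (by omega) (by omega)
      (by rwa [Polynomial.map_eq_zero_iff hinj, Polynomial.map_eq_zero_iff hinj])
      (natDegree_map_le.trans hP) (natDegree_map_le.trans hQ)
      (by simpa using map_dvd (mapRingHom (Int.castRingHom ℝ)) hdvd)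
    obtain ⟨c, Z₀, hc, hc1, hZ₀, H⟩ := pade_form_eq_zero_of_close (k := k) (d := d)
      (by omega) (by omega) (by omega) hP hQ hdvd
    refine ⟨min c c₀, Z₀, lt_min hc hc₀, (min_le_left _ _).trans hc1, hZ₀, ?_⟩
    intro Z Y hZ hY a₁ b₁ n₁ a₂ b₂ n₂ a₃ b₃ n₃ h₁ h₂ h₃ h12 h23 hle
    have hZ1 : 1 ≤ Z := hZ₀.trans hZ
    have hY1 := one_le_Y hZ1 hY
    have hz12 := one_lt (Nat.mul_pos h₂.a_pos h₁.b_pos) h12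
    have hz23 := one_lt (Nat.mul_pos h₃.a_pos h₂.b_pos) h23
    rw [ratio_mul h₁.b_pos h₂.a_pos h₂.b_pos h₃.a_pos] at hle
    have hle1 := hle.trans (add_le_add_right
      (div_le_div_of_nonneg_right (min_le_left c c₀) (by linarith : 0 ≤ Y)) 1)
    have hle2 := hle.trans (add_le_add_right
      ((div_le_self (le_min hc.le hc₀.le) hY1).trans (min_le_right c c₀)) 1)
    have hn : ∀ {a b n : ℕ}, IsTwinPoint k Z Y a b n → (0 : ℝ) < n :=
      fun h => by linarith [h.lt_n]
    have hn₁ := hn h₁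
    have hn₂ := hn h₂
    have hn₃ := hn h₃
    have F12 := H Z Y hZ hY a₁ b₁ n₁ a₂ b₂ n₂ h₁ h₂ _ rfl hz12.le (by nlinarith)
    have F23 := H Z Y hZ hY a₂ b₂ n₂ a₃ b₃ n₃ h₂ h₃ _ rfl hz23.le (by nlinarith)
    have F13 := H Z Y hZ hY a₁ b₁ n₁ a₃ b₃ n₃ h₁ h₃ _
      (ratio_mul h₁.b_pos h₂.a_pos h₂.b_pos h₃.a_pos).symm (by nlinarith) hle1
    refine hno _ _ (n₂ * (n₁ + 1) / (n₁ * (n₂ + 1))) (n₃ * (n₂ + 1) / (n₂ * (n₃ + 1)))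
      hz12 hz23 hle2 (by positivity) (by positivity) ?_ ?_ ?_
    · rw [div_mul_eq_mul_div, F12]; field_simp
    · rw [div_mul_eq_mul_div, F23]; field_simp
    · have : (n₂ * (n₁ + 1) / (n₁ * (n₂ + 1)) * (n₃ * (n₂ + 1) / (n₂ * (n₃ + 1))) : ℝ)
          = n₃ * (n₁ + 1) / (n₁ * (n₃ + 1)) := by field_simp
      rw [this, div_mul_eq_mul_div, F13]; field_simp

/-- Among three distinct elements some ordering is strictly monotone for an injective key. -/
theorem exists_lt_lt_of_two_lt_card {α : Type*} {s : Finset α} {f : α → ℝ}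
    (hf : Set.InjOn f s) (hs : 2 < s.card) :
    ∃ x ∈ s, ∃ y ∈ s, ∃ z ∈ s, f z < f y ∧ f y < f x := by
  obtain ⟨x, hx, y, hy, z, hz, hxy, hxz, hyz⟩ := Finset.two_lt_card.1 hs
  have h1 : f x ≠ f y := fun h => hxy (hf hx hy h)
  have h2 : f x ≠ f z := fun h => hxz (hf hx hz h)
  have h3 : f y ≠ f z := fun h => hyz (hf hy hz h)
  rcases lt_or_gt_of_ne h1 with a | a <;> rcases lt_or_gt_of_ne h2 with b | b <;>
    rcases lt_or_gt_of_ne h3 with c | c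
  · exact ⟨z, hz, y, hy, x, hx, a, c⟩
  · exact ⟨y, hy, z, hz, x, hx, b, c⟩
  · linarith
  · exact ⟨y, hy, x, hx, z, hz, b, a⟩
  · exact ⟨z, hz, x, hx, y, hy, a, b⟩
  · linarith
  · exact ⟨x, hx, z, hz, y, hy, c, b⟩
  · exact ⟨x, hx, y, hy, z, hz, c, a⟩

theorem card_twinPoints_le {k : ℕ} (hk : 2 ≤ k) {ε : ℝ} (hε : 0 < ε) :
    ∃ C Z₀ : ℝ, 0 < C ∧ 1 ≤ Z₀ ∧ ∀ Z Y : ℝ, Z₀ ≤ Z → Y = Z ^ (14 / (9 * (k : ℝ))) →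
      ∀ S : Finset (ℕ × ℕ × ℕ), (∀ t ∈ S, IsTwinPoint k Z Y t.1 t.2.1 t.2.2) →
      (S.card : ℝ) ≤ C * Z ^ (14 / (9 * (k : ℝ)) + ε) := by
  obtain ⟨c, Z₀, hc, hc1, hZ₀, H⟩ := not_three_twinPoints_close hk
  refine ⟨2 * (4 * (3 ^ ε / ε) / c + 3), Z₀, by positivity, hZ₀, ?_⟩
  intro Z Y hZ hY S hS
  have hZ1 : 1 ≤ Z := hZ₀.trans hZ
  have hY1 : 1 ≤ Y := by rw [hY]; exact Real.one_le_rpow hZ1 (by positivity)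
  have hYk : Z ≤ Y ^ k := by
    have hk0 : (k : ℝ) ≠ 0 := by positivity
    rw [hY, ← Real.rpow_natCast, ← Real.rpow_mul (by linarith)]
    refine Real.self_le_rpow_of_one_le hZ1 ?_
    field_simp
    norm_num
  set δ := c / (2 * Y) with hδ
  have hδ0 : 0 < δ := by positivity
  set ξ : ℕ × ℕ × ℕ → ℝ := fun t => Real.log t.1 - Real.log t.2.1 with hξ
  have hξinj : Set.InjOn ξ S := by
    intro s hs t ht hst
    have h1 := hS s hs
    have h2 := hS t ht
    have p1 : (0 : ℝ) < s.1 := by exact_mod_cast h1.a_pos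
    have p2 : (0 : ℝ) < s.2.1 := by exact_mod_cast h1.b_pos
    have p3 : (0 : ℝ) < t.1 := by exact_mod_cast h2.a_pos
    have p4 : (0 : ℝ) < t.2.1 := by exact_mod_cast h2.b_pos
    have h3 : Real.log (s.1 * t.2.1) = Real.log (t.1 * s.2.1) := by
      rw [Real.log_mul p1.ne' p4.ne', Real.log_mul p3.ne' p2.ne']
      simp only [hξ] at hst
      linarith
    have h4 : (s.1 * t.2.1 : ℝ) = t.1 * s.2.1 :=
      Real.log_injOn_pos (Set.mem_Ioi.2 (by positivity)) (Set.mem_Ioi.2 (by positivity)) h3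
    obtain ⟨e1, e2, e3⟩ := h1.eq_of_mul_eq (by omega) (by linarith) hYk h2 (by exact_mod_cast h4)
    exact Prod.ext e1 (Prod.ext e2 e3)
  set M := ⌈Real.log (3 * Z) / δ⌉₊ with hM
  have hlog0 : 0 ≤ Real.log (3 * Z) := Real.log_nonneg (by linarith)
  have hmaps : ∀ t ∈ S, ⌊ξ t / δ⌋ ∈ Finset.Icc (-(M : ℤ)) M := by
    intro t ht
    have h := hS t ht
    have p1 : (1 : ℝ) ≤ t.1 := by exact_mod_cast h.a_pos
    have p2 : (1 : ℝ) ≤ t.2.1 := by exact_mod_cast h.b_pos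
    have hn0 : 0 < t.2.2 := by
      have := h.lt_n
      have : (0 : ℝ) < t.2.2 := by linarith
      exact_mod_cast this
    have q1 : (t.1 : ℝ) ≤ 3 * Z := by
      have : t.1 ≤ t.2.2 := (Nat.le_self_pow (by omega) _).trans (Nat.le_of_dvd hn0 h.a_dvd)
      have : (t.1 : ℝ) ≤ t.2.2 := by exact_mod_cast this
      linarith [h.n_le]
    have q2 : (t.2.1 : ℝ) ≤ 3 * Z := by
      have : t.2.1 ≤ t.2.2 + 1 :=
        (Nat.le_self_pow (by omega) _).trans (Nat.le_of_dvd (Nat.succ_pos _) h.b_dvd)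
      have : (t.2.1 : ℝ) ≤ t.2.2 + 1 := by exact_mod_cast this
      linarith [h.n_le]
    have l1 := Real.log_le_log (by linarith) q1
    have l2 := Real.log_le_log (by linarith) q2
    have l3 := Real.log_nonneg p1
    have l4 := Real.log_nonneg p2
    have hceil := Nat.le_ceil (Real.log (3 * Z) / δ)
    rw [div_le_iff₀ hδ0] at hceil
    rw [Finset.mem_Icc, Int.le_floor]
    constructor
    · rw [le_div_iff₀ hδ0]
      push_cast
      simp only [hξ]
      linarith
    · rw [← Int.lt_add_one_iff, Int.floor_lt, div_lt_iff₀ hδ0]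
      push_cast
      simp only [hξ]
      linarith
  have hfiber : ∀ j ∈ Finset.Icc (-(M : ℤ)) M, (S.filter fun t => ⌊ξ t / δ⌋ = j).card ≤ 2 := by
    intro j _
    by_contra! hcard
    obtain ⟨x, hx, y, hy, z, hz, hzy, hyx⟩ := exists_lt_lt_of_two_lt_card (f := ξ)
      (hξinj.mono fun t ht => (Finset.mem_filter.1 ht).1) hcard
    rw [Finset.mem_filter] at hx hy hz
    have h1 := hS x hx.1
    have h2 := hS y hy.1
    have h3 := hS z hz.1
    have pos : ∀ {n : ℕ}, 0 < n → (0 : ℝ) < n := fun h => by exact_mod_cast h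
    have cross : ∀ s t : ℕ × ℕ × ℕ, IsTwinPoint k Z Y s.1 s.2.1 s.2.2 →
        IsTwinPoint k Z Y t.1 t.2.1 t.2.2 → ξ s < ξ t → s.1 * t.2.1 < t.1 * s.2.1 := by
      intro s t hs ht hlt
      have p1 := pos hs.a_pos
      have p2 := pos hs.b_pos
      have p3 := pos ht.a_pos
      have p4 := pos ht.b_pos
      have : (s.1 * t.2.1 : ℝ) < t.1 * s.2.1 := by
        rw [← Real.log_lt_log_iff (by positivity) (by positivity), Real.log_mul p1.ne' p4.ne',
          Real.log_mul p3.ne' p2.ne']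
        simp only [hξ] at hlt
        linarith
      exact_mod_cast this
    refine H Z Y hZ hY _ _ _ _ _ _ _ _ _ h1 h2 h3 (cross y x h2 h1 hyx) (cross z y h3 h2 hzy) ?_
    have p1 := pos h1.a_pos
    have p2 := pos h1.b_pos
    have p3 := pos h3.a_pos
    have p4 := pos h3.b_pos
    have hdiff : ξ x - ξ z ≤ δ := by
      have f1 := Int.lt_floor_add_one (ξ x / δ)
      have f2 := Int.floor_le (ξ z / δ)
      rw [hx.2, div_lt_iff₀ hδ0] at f1
      rw [hz.2, le_div_iff₀ hδ0] at f2
      linarith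
    have hδ1 : δ ≤ 1 := by
      rw [hδ, div_le_one (by positivity)]
      linarith
    have hexp : Real.exp δ ≤ 1 + 2 * δ := by
      have := Real.abs_exp_sub_one_le (x := δ) (by rwa [abs_of_pos hδ0])
      rw [abs_of_pos hδ0] at this
      linarith [le_abs_self (Real.exp δ - 1)]
    have h2δ : 2 * δ = c / Y := by
      rw [hδ]
      field_simp
    rw [← h2δ]
    refine le_trans ?_ hexp
    push_cast
    rw [← Real.log_le_iff_le_exp (by positivity), Real.log_div (by positivity) (by positivity),
      Real.log_mul p1.ne' p4.ne', Real.log_mul p3.ne' p2.ne']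
    simp only [hξ] at hdiff
    linarith
  have hcard := Finset.card_le_mul_card_image_of_maps_to hmaps 2 hfiber
  have hcardI : (Finset.Icc (-(M : ℤ)) M).card = 2 * M + 1 := by
    rw [Int.card_Icc]
    omega
  rw [hcardI] at hcard
  have hcardR : (S.card : ℝ) ≤ 2 * (2 * M + 1) := by exact_mod_cast hcard
  have hMle : (M : ℝ) ≤ Real.log (3 * Z) / δ + 1 :=
    (Nat.ceil_lt_add_one (by positivity)).le
  have hlog : Real.log (3 * Z) ≤ 3 ^ ε / ε * Z ^ ε := by
    refine (Real.log_le_rpow_div (by linarith) hε).trans_eq ?_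
    rw [Real.mul_rpow (by norm_num) (by linarith)]
    ring
  rw [Real.rpow_add (by linarith), ← hY]
  have hZε : 1 ≤ Z ^ ε := Real.one_le_rpow hZ1 hε.le
  have hdiv : Real.log (3 * Z) / δ = 2 * Y / c * Real.log (3 * Z) := by
    rw [hδ]
    field_simp
  have h1 : Real.log (3 * Z) / δ ≤ 2 * Y / c * (3 ^ ε / ε * Z ^ ε) := by
    rw [hdiv]
    gcongr
  have h2 : 1 ≤ Y * Z ^ ε := one_le_mul_of_one_le_of_one_le hY1 hZε
  calc (S.card : ℝ) ≤ 2 * (2 * (2 * Y / c * (3 ^ ε / ε * Z ^ ε)) + 3 * (Y * Z ^ ε)) := by linarith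
    _ = 2 * (4 * (3 ^ ε / ε) / c + 3) * (Y * Z ^ ε) := by ring

theorem kFree_iff_floorRoot_eq_one {k m : ℕ} :
    KFree k m ↔ Nat.floorRoot k m = 1 := by
  rw [Nat.eq_one_iff_not_exists_prime_dvd]
  simp only [KFree, Nat.pow_dvd_iff_dvd_floorRoot]

open ArithmeticFunction ArithmeticFunction.Moebius Classical in
theorem sum_moebius_pow_dvd {k m K : ℕ} (hk : k ≠ 0) (hm : m ≠ 0) (hK : m ≤ K) :
    (∑ a ∈ Finset.Icc 1 K, if a ^ k ∣ m then (μ a : ℝ) else 0) = if KFree k m then 1 else 0 := by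
  have hroot : Nat.floorRoot k m ≠ 0 := Nat.floorRoot_ne_zero.2 ⟨hk, hm⟩
  have hfilter : (Finset.Icc 1 K).filter (fun a => a ^ k ∣ m) = (Nat.floorRoot k m).divisors := by
    ext a
    rw [Finset.mem_filter, Finset.mem_Icc, Nat.mem_divisors, Nat.pow_dvd_iff_dvd_floorRoot]
    refine ⟨fun h => ⟨h.2, hroot⟩, fun h => ⟨⟨Nat.pos_of_dvd_of_pos h.1 hroot.bot_lt, ?_⟩, h.1⟩⟩
    have := Nat.le_of_dvd hm.bot_lt (Nat.pow_dvd_iff_dvd_floorRoot.2 h.1)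
    exact ((Nat.le_self_pow hk a).trans this).trans hK
  rw [← Finset.sum_filter, hfilter]
  have h := congrArg (fun f : ArithmeticFunction ℤ => f (Nat.floorRoot k m)) moebius_mul_coe_zeta
  rw [coe_mul_zeta_apply, one_apply] at h
  rw [if_congr kFree_iff_floorRoot_eq_one rfl rfl]
  exact_mod_cast h

/-- Each pair of coprime moduli is hit by consecutive integers in a single residue class. -/
theorem abs_card_dvd_dvd_succ_sub_le {u v : ℕ} (hu : 0 < u) (hv : 0 < v) (huv : u.Coprime v)
    {N M : ℕ} (hNM : N ≤ M) :
    |(((Finset.Ioc N M).filter fun n => u ∣ n ∧ v ∣ n + 1).card : ℝ) - (M - N) / (u * v)| ≤ 1 := by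
  obtain ⟨x, hx⟩ := Nat.chineseRemainder huv 0 (v - 1)
  have huv0 : 0 < u * v := Nat.mul_pos hu hv
  have hfilter : (Finset.Ioc N M).filter (fun n => u ∣ n ∧ v ∣ n + 1)
      = (Finset.Ioc N M).filter (fun n => n ≡ x [MOD u * v]) := by
    refine Finset.filter_congr fun n _ => ?_
    rw [← Nat.modEq_and_modEq_iff_modEq_mul huv]
    refine and_congr ?_ ?_
    · rw [← Nat.modEq_zero_iff_dvd]
      exact ⟨fun h => h.trans hx.1.symm, fun h => h.trans hx.1⟩
    · rw [← Nat.modEq_zero_iff_dvd]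
      have h1 : x + 1 ≡ 0 [MOD v] := by
        have := hx.2.add_right 1
        rw [Nat.sub_add_cancel hv] at this
        exact this.trans (by simp [Nat.ModEq])
      exact ⟨fun h => Nat.ModEq.add_right_cancel' 1 (h.trans h1.symm),
        fun h => (h.add_right 1).trans h1⟩
  have hcard := Nat.Ioc_filter_modEq_card N M huv0 x
  rw [← hfilter] at hcard
  set t := ((Finset.Ioc N M).filter fun n => u ∣ n ∧ v ∣ n + 1).card
  have huvQ : (0 : ℚ) < (u * v : ℕ) := by exact_mod_cast huv0
  have hNMQ : (N : ℚ) ≤ M := by exact_mod_cast hNM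
  rw [max_eq_left (sub_nonneg.2 (Int.floor_le_floor (by gcongr)))] at hcard
  have hcardQ : (t : ℚ) = (⌊((M : ℚ) - x) / (u * v : ℕ)⌋ : ℚ) - ⌊((N : ℚ) - x) / (u * v : ℕ)⌋ := by
    exact_mod_cast hcard
  have hQ : |(t : ℚ) - (M - N) / (u * v)| ≤ 1 := by
    have e : ((M : ℚ) - N) / (u * v)
        = ((M : ℚ) - x) / (u * v : ℕ) - ((N : ℚ) - x) / (u * v : ℕ) := by
      push_cast
      ring
    rw [e, hcardQ, abs_le]
    have f1 := Int.floor_le (((M : ℚ) - x) / (u * v : ℕ))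
    have f2 := Int.lt_floor_add_one (((M : ℚ) - x) / (u * v : ℕ))
    have f3 := Int.floor_le (((N : ℚ) - x) / (u * v : ℕ))
    have f4 := Int.lt_floor_add_one (((N : ℚ) - x) / (u * v : ℕ))
    constructor <;> linarith
  have : ((|(t : ℚ) - (M - N) / (u * v)| : ℚ) : ℝ) ≤ ((1 : ℚ) : ℝ) := Rat.cast_le.2 hQ
  push_cast at this
  exact this

open Classical in
theorem AstarCount_eq_card {k : ℕ} {Z : ℝ} (hZ : 0 ≤ Z) :
    AstarCount k Z
      = ((Finset.Ioc ⌊Z⌋₊ ⌊2 * Z⌋₊).filter fun n => KFree k n ∧ KFree k (n + 1)).card := by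
  have key : ∀ W : ℝ, 0 ≤ W → Acount k W
      = ((Finset.Ioc 0 ⌊W⌋₊).filter fun n => KFree k n ∧ KFree k (n + 1)).card := by
    intro W hW
    rw [Acount, ← Set.ncard_coe_finset]
    congr 1
    ext n
    simp only [Set.mem_ofPred_eq, Finset.coe_filter, Finset.mem_Ioc, Nat.le_floor_iff hW, and_assoc]
  have hle : ⌊Z⌋₊ ≤ ⌊2 * Z⌋₊ := Nat.floor_le_floor (by linarith)
  rw [AstarCount, key _ hZ, key _ (by linarith), ← Finset.Ioc_union_Ioc_eq_Ioc (Nat.zero_le _) hle,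
    Finset.filter_union, Finset.card_union_of_disjoint]
  · push_cast
    ring
  · exact Finset.disjoint_filter_filter (Finset.Ioc_disjoint_Ioc_of_le le_rfl)

theorem summable_natCast_mul_rpow_neg {s : ℝ} (hs : 1 < s) :
    Summable fun p : ℕ × ℕ => ((p.1 * p.2 : ℕ) : ℝ) ^ (-s) := by
  have h := Real.summable_nat_rpow.2 (neg_lt_neg hs)
  refine (h.mul_of_nonneg h (fun _ => by positivity) fun _ => by positivity).congr fun p => ?_
  rw [Nat.cast_mul, Real.mul_rpow (by positivity) (by positivity)]

section

open ArithmeticFunction ArithmeticFunction.Moebius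

theorem summable_moebius_mul_div_pow {k : ℕ} (hk : 2 ≤ k) :
    Summable fun p : ℕ × ℕ => (μ (p.1 * p.2) : ℝ) / ((p.1 * p.2 : ℕ) : ℝ) ^ k := by
  have hs : (1 : ℝ) < k := by exact_mod_cast hk
  refine Summable.of_norm_bounded (summable_natCast_mul_rpow_neg hs) fun p => ?_
  rw [Real.rpow_neg (by positivity), Real.rpow_natCast, norm_div, div_eq_mul_inv,
    Real.norm_of_nonneg (by positivity : (0 : ℝ) ≤ ((p.1 * p.2 : ℕ) : ℝ) ^ k)]
  refine mul_le_of_le_one_left (by positivity) ?_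
  rw [Real.norm_eq_abs]
  exact_mod_cast abs_moebius_le_one (n := p.1 * p.2)

theorem hasSum_moebius_mul_card_divisors {k : ℕ} (hk : 2 ≤ k) :
    HasSum (fun n : ℕ => (μ n : ℝ) * n.divisors.card / (n : ℝ) ^ k)
      (∑' p : ℕ × ℕ, (μ (p.1 * p.2) : ℝ) / ((p.1 * p.2 : ℕ) : ℝ) ^ k) := by
  refine ((summable_moebius_mul_div_pow hk).hasSum.tsum_fiberwise fun p => p.1 * p.2).congr_fun ?_
  intro n
  rcases Nat.eq_zero_or_pos n with rfl | hn
  · have h0 : ∀ p : (fun p : ℕ × ℕ => p.1 * p.2) ⁻¹' {0},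
        (μ (p.1.1 * p.1.2) : ℝ) / ((p.1.1 * p.1.2 : ℕ) : ℝ) ^ k = 0 := by
      rintro ⟨p, hp⟩
      rw [Set.mem_preimage, Set.mem_singleton_iff] at hp
      simp [hp]
    rw [tsum_congr h0]
    simp
  have hfiber : (fun p : ℕ × ℕ => p.1 * p.2) ⁻¹' {n} = (n.divisorsAntidiagonal : Set (ℕ × ℕ)) := by
    ext p
    simp [hn.ne']
  rw [hfiber, Finset.tsum_subtype' n.divisorsAntidiagonal
    fun p : ℕ × ℕ => (μ (p.1 * p.2) : ℝ) / ((p.1 * p.2 : ℕ) : ℝ) ^ k]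
  rw [Finset.sum_congr rfl fun p hp => by rw [(Nat.mem_divisorsAntidiagonal.1 hp).1],
    Finset.sum_const, nsmul_eq_mul, ← Nat.map_div_right_divisors, Finset.card_map]
  ring

theorem ck_eq_tsum {k : ℕ} (hk : 2 ≤ k) :
    ck k = ∑' p : ℕ × ℕ, (μ (p.1 * p.2) : ℝ) / ((p.1 * p.2 : ℕ) : ℝ) ^ k := by
  have h := hasSum_moebius_mul_card_divisors hk
  rw [← h.tsum_eq, ck]
  have hprod := EulerProduct.eulerProduct_hasProd
    (f := fun n : ℕ => (μ n : ℝ) * n.divisors.card / (n : ℝ) ^ k) (by simp)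
    (fun {m n} hmn => by
      rw [isMultiplicative_moebius.map_mul_of_coprime hmn, hmn.card_divisors_mul]
      push_cast
      ring) h.summable.norm (by simp)
  rw [← hprod.tprod_eq]
  refine tprod_congr fun p => ?_
  rw [tsum_eq_sum (s := {0, 1})]
  · simp [moebius_apply_prime p.2, p.2.divisors, p.2.one_lt.ne]
    ring
  · intro e he
    simp only [Finset.mem_insert, Finset.mem_singleton, not_or] at he
    simp [moebius_apply_prime_pow p.2 he.1, he.2]

/-- Rankin's trick for counting pairs with bounded product. -/
theorem card_filter_mul_le_rankin {s : ℝ} (hs : 1 < s) {Y : ℝ} (hY : 0 ≤ Y)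
    (T : Finset (ℕ × ℕ)) (hT : ∀ p ∈ T, 0 < p.1 * p.2 ∧ (p.1 * p.2 : ℝ) ≤ Y) :
    (T.card : ℝ) ≤ (∑' p : ℕ × ℕ, ((p.1 * p.2 : ℕ) : ℝ) ^ (-s)) * Y ^ s := by
  rw [← tsum_mul_right]
  have hsum := (summable_natCast_mul_rpow_neg hs).mul_right (Y ^ s)
  refine le_trans ?_ (hsum.sum_le_tsum T fun p _ => by positivity)
  rw [Finset.card_eq_sum_ones, Nat.cast_sum]
  refine Finset.sum_le_sum fun p hp => ?_
  obtain ⟨h0, h1⟩ := hT p hp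
  have h0' : (0 : ℝ) < ((p.1 * p.2 : ℕ) : ℝ) := by exact_mod_cast h0
  rw [Real.rpow_neg h0'.le, inv_mul_eq_div, Nat.cast_one, one_le_div (by positivity)]
  exact Real.rpow_le_rpow h0'.le (by exact_mod_cast h1) (by linarith)

theorem abs_tsum_sub_sum_moebius_le {k : ℕ} (hk : 2 ≤ k) {s : ℝ} (hs : 1 < s) (hsk : s ≤ k)
    {Y : ℝ} (hY : 0 < Y) (T : Finset (ℕ × ℕ))
    (hT : ∀ p ∉ T, 0 < p.1 * p.2 → Y ≤ p.1 * p.2) :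
    |ck k - ∑ p ∈ T, (μ (p.1 * p.2) : ℝ) / ((p.1 * p.2 : ℕ) : ℝ) ^ k|
      ≤ (∑' p : ℕ × ℕ, ((p.1 * p.2 : ℕ) : ℝ) ^ (-s)) * Y ^ (s - k) := by
  have hg := summable_moebius_mul_div_pow hk
  have hh := (summable_natCast_mul_rpow_neg hs).mul_right (Y ^ (s - k))
  rw [ck_eq_tsum hk, ← hg.sum_add_tsum_compl (s := T), add_sub_cancel_left, ← tsum_mul_right]
  have hle : ∀ p : ((T : Set (ℕ × ℕ))ᶜ : Set (ℕ × ℕ)),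
      ‖(μ (p.1.1 * p.1.2) : ℝ) / ((p.1.1 * p.1.2 : ℕ) : ℝ) ^ k‖
        ≤ ((p.1.1 * p.1.2 : ℕ) : ℝ) ^ (-s) * Y ^ (s - k) := by
    rintro ⟨p, hp⟩
    dsimp only
    rcases Nat.eq_zero_or_pos (p.1 * p.2) with h0 | h0
    · rw [h0]
      simp only [ArithmeticFunction.map_zero, Int.cast_zero, zero_div, norm_zero]
      positivity
    have hY' : Y ≤ ((p.1 * p.2 : ℕ) : ℝ) := by exact_mod_cast hT p (by simpa using hp) h0
    have h0' : (0 : ℝ) < ((p.1 * p.2 : ℕ) : ℝ) := by exact_mod_cast h0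
    have hμ : |(μ (p.1 * p.2) : ℝ)| ≤ 1 := by
      exact_mod_cast abs_moebius_le_one (n := p.1 * p.2)
    rw [norm_div, Real.norm_eq_abs, Real.norm_of_nonneg (by positivity), ← Real.rpow_natCast]
    set x := ((p.1 * p.2 : ℕ) : ℝ)
    calc |(μ (p.1 * p.2) : ℝ)| / x ^ (k : ℝ) ≤ 1 / x ^ (k : ℝ) := by gcongr
      _ = x ^ (-s) * x ^ (s - k) := by
        rw [← Real.rpow_add h0', one_div, ← Real.rpow_neg h0'.le]
        congr 1
        ring
      _ ≤ x ^ (-s) * Y ^ (s - k) := mul_le_mul_of_nonneg_left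
        (Real.rpow_le_rpow_of_nonpos hY hY' (by linarith)) (by positivity)
  rw [← Real.norm_eq_abs]
  refine (tsum_of_norm_bounded (hh.subtype _).hasSum hle).trans ?_
  exact hh.tsum_subtype_le _ _ (fun p => by positivity)

theorem ite_moebius_mul_ite_moebius {k a b n : ℕ} (hk : 0 < k) :
    ((if a ^ k ∣ n then (μ a : ℝ) else 0) * if b ^ k ∣ n + 1 then (μ b : ℝ) else 0)
      = if a ^ k ∣ n ∧ b ^ k ∣ n + 1 then (μ (a * b) : ℝ) else 0 := by
  by_cases ha : a ^ k ∣ n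
  · by_cases hb : b ^ k ∣ n + 1
    · have h : (a ^ k).Coprime (b ^ k) :=
        Nat.Coprime.coprime_dvd_left ha (Nat.Coprime.coprime_dvd_right hb (by simp))
      have hab : a.Coprime b :=
        (Nat.coprime_pow_left_iff hk _ _).1 ((Nat.coprime_pow_right_iff hk _ _).1 h)
      rw [if_pos ha, if_pos hb, if_pos ⟨ha, hb⟩, isMultiplicative_moebius.map_mul_of_coprime hab]
      push_cast
      ring
    · simp [hb]
  · simp [ha]

/-- The number of `n ∈ (N, M]` with `a ^ k ∣ n` and `b ^ k ∣ n + 1`. -/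
def twinCount (k N M a b : ℕ) : ℕ :=
  ((Finset.Ioc N M).filter fun n => a ^ k ∣ n ∧ b ^ k ∣ n + 1).card

theorem AstarCount_eq_sum {k K : ℕ} (hk : 0 < k) {Z : ℝ} (hZ : 0 ≤ Z) (hK : ⌊2 * Z⌋₊ < K) :
    AstarCount k Z = ∑ p ∈ Finset.Icc 1 K ×ˢ Finset.Icc 1 K,
      (μ (p.1 * p.2) : ℝ) * twinCount k ⌊Z⌋₊ ⌊2 * Z⌋₊ p.1 p.2 := by
  classical
  have hterm : ∀ n ∈ Finset.Ioc ⌊Z⌋₊ ⌊2 * Z⌋₊,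
      (if KFree k n ∧ KFree k (n + 1) then (1 : ℝ) else 0)
        = ∑ p ∈ Finset.Icc 1 K ×ˢ Finset.Icc 1 K,
          if p.1 ^ k ∣ n ∧ p.2 ^ k ∣ n + 1 then (μ (p.1 * p.2) : ℝ) else 0 := by
    intro n hn
    rw [Finset.mem_Ioc] at hn
    rw [ite_and, ← mul_one (1 : ℝ), ← mul_ite_zero, ← ite_zero_mul,
      ← sum_moebius_pow_dvd (K := K) hk.ne' (by omega : n ≠ 0) (by omega),
      ← sum_moebius_pow_dvd (K := K) hk.ne' n.succ_ne_zero (by omega), Finset.sum_mul_sum,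
      Finset.sum_product]
    simp only [ite_moebius_mul_ite_moebius hk]
  rw [AstarCount_eq_card hZ, Finset.card_filter, Nat.cast_sum]
  push_cast
  rw [Finset.sum_congr rfl hterm, Finset.sum_comm]
  refine Finset.sum_congr rfl fun p _ => ?_
  rw [← Finset.sum_filter, Finset.sum_const, nsmul_eq_mul, mul_comm, twinCount]

theorem abs_moebius_mul_twinCount_sub_le {k a b : ℕ} (ha : 0 < a) (hb : 0 < b) {Z : ℝ}
    (hZ : 0 ≤ Z) :
    |(μ (a * b) : ℝ) * twinCount k ⌊Z⌋₊ ⌊2 * Z⌋₊ a b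
      - (μ (a * b) : ℝ) / ((a * b : ℕ) : ℝ) ^ k * Z| ≤ 2 := by
  by_cases hab : a.Coprime b
  · have hcard := abs_card_dvd_dvd_succ_sub_le (pow_pos ha k) (pow_pos hb k) (hab.pow k k)
      (Nat.floor_le_floor (by linarith) : ⌊Z⌋₊ ≤ ⌊2 * Z⌋₊)
    rw [← twinCount] at hcard
    set t := (twinCount k ⌊Z⌋₊ ⌊2 * Z⌋₊ a b : ℝ)
    have hx : (1 : ℝ) ≤ ((a * b : ℕ) : ℝ) ^ k := by
      exact_mod_cast Nat.one_le_pow _ _ (Nat.mul_pos ha hb)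
    have hpow : ((a ^ k : ℕ) : ℝ) * (b ^ k : ℕ) = ((a * b : ℕ) : ℝ) ^ k := by
      push_cast
      ring
    rw [hpow] at hcard
    set x := ((a * b : ℕ) : ℝ) ^ k
    have hfloor : |((⌊2 * Z⌋₊ : ℝ) - ⌊Z⌋₊) / x - Z / x| ≤ 1 := by
      rw [← sub_div, abs_div, abs_of_nonneg (by linarith : 0 ≤ x)]
      refine (div_le_self (abs_nonneg _) hx).trans ?_
      rw [abs_le]
      have f1 := Nat.floor_le hZ
      have f2 := Nat.lt_floor_add_one Z
      have f3 := Nat.floor_le (by linarith : 0 ≤ 2 * Z)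
      have f4 := Nat.lt_floor_add_one (2 * Z)
      constructor <;> linarith
    have hμ : |(μ (a * b) : ℝ)| ≤ 1 := by exact_mod_cast abs_moebius_le_one (n := a * b)
    have hsplit : (μ (a * b) : ℝ) * t - (μ (a * b) : ℝ) / x * Z = μ (a * b) * (t - Z / x) := by
      ring
    have htri := abs_sub_le t (((⌊2 * Z⌋₊ : ℝ) - ⌊Z⌋₊) / x) (Z / x)
    rw [hsplit, abs_mul]
    exact (mul_le_of_le_one_left (abs_nonneg _) hμ).trans (by linarith)
  · have : μ (a * b) = 0 :=
      moebius_eq_zero_of_not_squarefree fun h => hab (Nat.squarefree_mul_iff.1 h).1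
    simp [this]

theorem sum_twinCount_eq_card (k N M : ℕ) (U : Finset (ℕ × ℕ)) :
    ∑ p ∈ U, twinCount k N M p.1 p.2
      = (((U ×ˢ Finset.Ioc N M).filter fun t => t.1.1 ^ k ∣ t.2 ∧ t.1.2 ^ k ∣ t.2 + 1).map
          (Equiv.prodAssoc ℕ ℕ ℕ).toEmbedding).card := by
  rw [Finset.card_map, Finset.card_filter, Finset.sum_product]
  exact Finset.sum_congr rfl fun p _ => Finset.card_filter _ _

theorem abs_AstarCount_sub_le_of_le {k : ℕ} (hk : 2 ≤ k) {ε : ℝ} (hε : 0 < ε) :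
    ∃ C Z₀ : ℝ, 0 < C ∧ 1 ≤ Z₀ ∧ ∀ Z : ℝ, Z₀ ≤ Z →
      |AstarCount k Z - ck k * Z| ≤ C * Z ^ (14 / (9 * (k : ℝ)) + ε) := by
  obtain ⟨C, Z₀, hC, hZ₀, htwin⟩ := card_twinPoints_le hk hε
  have hk2 : (2 : ℝ) ≤ k := by exact_mod_cast hk
  set s := 1 + min ε 1 with hs_def
  have hs : 1 < s := by
    have : 0 < min ε 1 := lt_min hε one_pos
    linarith
  have hsk : s ≤ k := by linarith [min_le_right ε 1]
  set H := ∑' p : ℕ × ℕ, ((p.1 * p.2 : ℕ) : ℝ) ^ (-s)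
  have hH : 0 ≤ H := tsum_nonneg fun p => by positivity
  refine ⟨3 * H + C, Z₀, by positivity, hZ₀, fun Z hZ => ?_⟩
  have hZ1 : 1 ≤ Z := hZ₀.trans hZ
  have hZ0 : 0 < Z := by linarith
  set θ := 14 / (9 * (k : ℝ)) with hθ
  obtain ⟨Y, hY⟩ : ∃ Y, Y = Z ^ θ := ⟨_, rfl⟩
  have hY0 : 0 < Y := by rw [hY]; positivity
  have hθ0 : 0 ≤ θ := by positivity
  have hθ1 : θ ≤ 1 := by
    rw [hθ, div_le_one (by positivity)]
    linarith
  have hYs : Y ^ s ≤ Z ^ (θ + ε) := by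
    rw [hY, ← Real.rpow_mul hZ0.le]
    refine Real.rpow_le_rpow_of_exponent_le hZ1 ?_
    have h1 := mul_le_mul_of_nonneg_left (min_le_left ε 1) hθ0
    have h2 := mul_le_mul_of_nonneg_right hθ1 hε.le
    rw [hs_def, mul_add]
    linarith
  have hYsk : Z * Y ^ (s - k) ≤ Z ^ (θ + ε) := by
    refine le_trans ?_ hYs
    rw [Real.rpow_sub hY0, ← mul_div_assoc, div_le_iff₀ (by positivity), mul_comm]
    refine mul_le_mul_of_nonneg_left ?_ (by positivity)
    rw [hY, ← Real.rpow_mul hZ0.le]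
    refine Real.self_le_rpow_of_one_le hZ1 ?_
    rw [hθ]
    field_simp
    norm_num
  set K := ⌊Y⌋₊ + ⌊2 * Z⌋₊ + 1 with hK
  set D := Finset.Icc 1 K ×ˢ Finset.Icc 1 K with hD
  set T := D.filter fun p => (p.1 * p.2 : ℝ) ≤ Y with hT
  set U := D.filter fun p => ¬ (p.1 * p.2 : ℝ) ≤ Y with hU
  have hmemD : ∀ p ∈ D, 0 < p.1 ∧ 0 < p.2 := by
    intro p hp
    simp only [hD, Finset.mem_product, Finset.mem_Icc] at hp
    omega
  have hcompl : ∀ p ∉ T, 0 < p.1 * p.2 → Y ≤ p.1 * p.2 := by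
    intro p hp h0
    by_contra! hlt
    have h1 : p.1 * p.2 ≤ ⌊Y⌋₊ := Nat.le_floor (by push_cast; exact hlt.le)
    have h2 := Nat.pos_of_mul_pos_right h0
    have h3 := Nat.pos_of_mul_pos_left h0
    refine hp (Finset.mem_filter.2 ⟨?_, hlt.le⟩)
    simp only [hD, Finset.mem_product, Finset.mem_Icc]
    refine ⟨⟨?_, ?_⟩, ?_, ?_⟩ <;> nlinarith
  have hcardT : (T.card : ℝ) ≤ H * Z ^ (θ + ε) := by
    refine (card_filter_mul_le_rankin hs hY0.le T fun p hp => ?_).trans (by gcongr)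
    rw [hT, Finset.mem_filter] at hp
    exact ⟨Nat.mul_pos (hmemD p hp.1).1 (hmemD p hp.1).2, hp.2⟩
  have hsumU : |∑ p ∈ U, (μ (p.1 * p.2) : ℝ) * twinCount k ⌊Z⌋₊ ⌊2 * Z⌋₊ p.1 p.2|
      ≤ C * Z ^ (θ + ε) := by
    calc |∑ p ∈ U, (μ (p.1 * p.2) : ℝ) * twinCount k ⌊Z⌋₊ ⌊2 * Z⌋₊ p.1 p.2|
        ≤ ∑ p ∈ U, |(μ (p.1 * p.2) : ℝ) * twinCount k ⌊Z⌋₊ ⌊2 * Z⌋₊ p.1 p.2| :=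
          Finset.abs_sum_le_sum_abs _ _
      _ ≤ ∑ p ∈ U, (twinCount k ⌊Z⌋₊ ⌊2 * Z⌋₊ p.1 p.2 : ℝ) := by
          refine Finset.sum_le_sum fun p _ => ?_
          rw [abs_mul, Nat.abs_cast]
          refine mul_le_of_le_one_left (Nat.cast_nonneg _) ?_
          exact_mod_cast abs_moebius_le_one (n := p.1 * p.2)
      _ ≤ C * Z ^ (θ + ε) := by
          rw [← Nat.cast_sum, sum_twinCount_eq_card]
          refine htwin Z Y hZ hY _ fun t ht => ?_
          simp only [Finset.mem_map_equiv, Equiv.prodAssoc_symm_apply, Finset.mem_filter,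
            Finset.mem_product, Finset.mem_Ioc, hU, not_le] at ht
          obtain ⟨⟨⟨hD', hlt⟩, hN, hM⟩, hadvd, hbdvd⟩ := ht
          exact ⟨(hmemD _ hD').1, (hmemD _ hD').2, (Nat.floor_lt hZ0.le).1 hN,
            (Nat.le_floor_iff (by positivity)).1 hM, hadvd, hbdvd, hlt⟩
  have hsumT : |∑ p ∈ T, (μ (p.1 * p.2) : ℝ) * twinCount k ⌊Z⌋₊ ⌊2 * Z⌋₊ p.1 p.2
      - (∑ p ∈ T, (μ (p.1 * p.2) : ℝ) / ((p.1 * p.2 : ℕ) : ℝ) ^ k) * Z| ≤ 2 * T.card := by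
    rw [Finset.sum_mul, ← Finset.sum_sub_distrib]
    refine (Finset.abs_sum_le_sum_abs _ _).trans ?_
    refine (Finset.sum_le_card_nsmul T _ 2 fun p hp => ?_).trans_eq (by rw [nsmul_eq_mul, mul_comm])
    have := hmemD p (Finset.mem_filter.1 hp).1
    exact abs_moebius_mul_twinCount_sub_le this.1 this.2 hZ0.le
  have hseries := abs_tsum_sub_sum_moebius_le hk hs hsk hY0 T hcompl
  have hsplit : AstarCount k Z
      = ∑ p ∈ T, (μ (p.1 * p.2) : ℝ) * twinCount k ⌊Z⌋₊ ⌊2 * Z⌋₊ p.1 p.2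
        + ∑ p ∈ U, (μ (p.1 * p.2) : ℝ) * twinCount k ⌊Z⌋₊ ⌊2 * Z⌋₊ p.1 p.2 := by
    rw [AstarCount_eq_sum (K := K) (by omega) hZ0.le (by omega), hT, hU,
      Finset.sum_filter_add_sum_filter_not]
  set A := ∑ p ∈ T, (μ (p.1 * p.2) : ℝ) * twinCount k ⌊Z⌋₊ ⌊2 * Z⌋₊ p.1 p.2
  set B := ∑ p ∈ U, (μ (p.1 * p.2) : ℝ) * twinCount k ⌊Z⌋₊ ⌊2 * Z⌋₊ p.1 p.2
  set G := ∑ p ∈ T, (μ (p.1 * p.2) : ℝ) / ((p.1 * p.2 : ℕ) : ℝ) ^ k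
  have hseriesZ : |(ck k - G) * Z| ≤ H * Z ^ (θ + ε) := by
    rw [abs_mul, abs_of_pos hZ0]
    calc |ck k - G| * Z ≤ H * Y ^ (s - k) * Z := by gcongr
      _ = H * (Z * Y ^ (s - k)) := by ring
      _ ≤ H * Z ^ (θ + ε) := by gcongr
  have e : AstarCount k Z - ck k * Z = (A - G * Z) + B - (ck k - G) * Z := by
    rw [hsplit]
    ring
  rw [e]
  have t1 := abs_sub (A - G * Z + B) ((ck k - G) * Z)
  have t2 := abs_add_le (A - G * Z) B
  linarith

theorem abs_AstarCount_le {k : ℕ} {Z : ℝ} (hZ : 0 ≤ Z) : |AstarCount k Z| ≤ 2 * Z := by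
  classical
  rw [AstarCount_eq_card hZ, Nat.abs_cast]
  refine le_trans ?_ (Nat.floor_le (by linarith : 0 ≤ 2 * Z))
  refine Nat.cast_le.2 ((Finset.card_filter_le _ _).trans ?_)
  rw [Nat.card_Ioc]
  exact Nat.sub_le _ _

end

theorem stmt_1 (k : ℕ) (hk : 2 ≤ k) (ε : ℝ) (hε : 0 < ε) :
    ∃ C : ℝ, 0 < C ∧ ∀ Z : ℝ, 1 ≤ Z →
      |AstarCount k Z - ck k * Z| ≤ C * Z ^ (14 / (9 * (k : ℝ)) + ε) := by
  obtain ⟨C, Z₀, hC, hZ₀, h⟩ := abs_AstarCount_sub_le_of_le hk hε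
  refine ⟨C + (2 + |ck k|) * Z₀, by positivity, fun Z hZ => ?_⟩
  have hone : 1 ≤ Z ^ (14 / (9 * (k : ℝ)) + ε) := Real.one_le_rpow hZ (by positivity)
  rcases le_total Z₀ Z with hle | hle
  · refine (h Z hle).trans (mul_le_mul_of_nonneg_right ?_ (by linarith))
    exact le_add_of_nonneg_right (by positivity)
  · calc |AstarCount k Z - ck k * Z| ≤ |AstarCount k Z| + |ck k * Z| := abs_sub _ _
      _ ≤ 2 * Z + |ck k| * Z := by
        rw [abs_mul, abs_of_nonneg (by linarith : 0 ≤ Z)]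
        linarith [abs_AstarCount_le (k := k) (by linarith : 0 ≤ Z)]
      _ = (2 + |ck k|) * Z := by ring
      _ ≤ (2 + |ck k|) * Z₀ := by gcongr
      _ ≤ C + (2 + |ck k|) * Z₀ := by linarith
      _ ≤ (C + (2 + |ck k|) * Z₀) * Z ^ (14 / (9 * (k : ℝ)) + ε) :=
        le_mul_of_one_le_right (by positivity) hone
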